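/- There exist constants γ₀ ∈ (0,1) and K > 0 such that the following holds. Let q ∈ (0,1), let γ ∈ (0,γ₀), and let q₁, q₂, q₃ > 0 satisfy q₁+q₂+q₃ = q and (1−γ)·q/3 < q_k < (1+γ)·q/3 for each k ∈ {1,2,3}. Then Q is irreducible with unique stationary distribution π, and for every ε ∈ (0,1) its mixing time satisfies t_mix(ε) ≤ (K/q)·(1 + log(1/ε)). -/

import Mathlib

/-- Edge type of a state: backward (`b`) or forward (`f`). -/
inductive Edge : Type
  | b | f
deriving DecidableEq

instance : Fintype Edge := ⟨{Edge.b, Edge.f}, fun x => by cases x <;> simp⟩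

/-- The 18-element state space `𝒱`: states `A_e^(k)` are encoded as
`Sum.inl (e, k)` and states `B_e^(kℓ)` (with `k ≠ ℓ`) as `Sum.inr (e, ⟨(k, ℓ), _⟩)`. -/
abbrev St : Type := (Edge × Fin 3) ⊕ (Edge × {kl : Fin 3 × Fin 3 // kl.1 ≠ kl.2})

/-- The element of `{0,1,2}` different from both `k` and `l` (when `k ≠ l`). -/
def third (k l : Fin 3) : Fin 3 :=
  ⟨(6 - (k : ℕ) - (l : ℕ)) % 3, Nat.mod_lt _ (by norm_num)⟩

/-- The transition matrix `Q` with parameters `q₁ = qv 0`, `q₂ = qv 1`, `q₃ = qv 2`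
(and `q = qv 0 + qv 1 + qv 2`); all entries not prescribed by the rules are `0`. -/
noncomputable def Qmat (qv : Fin 3 → ℝ) : Matrix St St ℝ :=
  Matrix.of fun s t =>
    match s, t with
    | Sum.inl (_, k), Sum.inl (Edge.b, j) => if j = k then 0 else qv (third k j)
    | Sum.inl (_, _), Sum.inl (Edge.f, _) => 0
    | Sum.inl (_, k), Sum.inr (Edge.f, kl) =>
        if kl.1.1 = k then (1 - (qv 0 + qv 1 + qv 2)) / 2 else 0
    | Sum.inl (_, k), Sum.inr (Edge.b, kl) => if kl.1.1 = k then qv k / 2 else 0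
    | Sum.inr (_, kl), Sum.inl (Edge.b, j) =>
        if j = kl.1.1 then qv (third kl.1.1 kl.1.2) else 0
    | Sum.inr (_, kl), Sum.inl (Edge.f, j) =>
        if j = third kl.1.1 kl.1.2 then 1 - (qv 0 + qv 1 + qv 2) else 0
    | Sum.inr (_, kl), Sum.inr (Edge.b, kl') =>
        if kl'.1.1 = kl.1.1 ∧ kl'.1.2 = third kl.1.1 kl.1.2 then qv kl.1.1
        else if kl'.1.1 = kl.1.2 ∧ kl'.1.2 = third kl.1.1 kl.1.2 then qv kl.1.2
        else 0
    | Sum.inr _, Sum.inr (Edge.f, _) => 0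

/-- The balanced transition matrix `Q_bal`, i.e. `Q` with `q₁ = q₂ = q₃ = q/3`. -/
noncomputable def Qbal (q : ℝ) : Matrix St St ℝ := Qmat fun _ => q / 3

/-- The distribution `π_bal` on `𝒱`. -/
noncomputable def piBal (q : ℝ) : St → ℝ
  | Sum.inl (Edge.b, _) => q / 6
  | Sum.inl (Edge.f, _) => (1 - q) / 6
  | Sum.inr (Edge.b, _) => q / 12
  | Sum.inr (Edge.f, _) => (1 - q) / 12

section Stochastic

open Matrix

variable {n : Type*} [Fintype n] [DecidableEq n] {P : Matrix n n ℝ}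

theorem sum_vecMul_of_mem_rowStochastic (hP : P ∈ rowStochastic ℝ n) (v : n → ℝ) :
    ∑ y, (v ᵥ* P) y = ∑ x, v x := by
  simp only [vecMul, dotProduct]
  rw [Finset.sum_comm]
  simp [← Finset.mul_sum, sum_row_of_mem_rowStochastic hP]

/-- Every finite row-stochastic matrix has a stationary distribution. -/
theorem exists_stationary_of_mem_rowStochastic [Nonempty n] (hP : P ∈ rowStochastic ℝ n) :
    ∃ v : n → ℝ, (∀ x, 0 ≤ v x) ∧ ∑ x, v x = 1 ∧ v ᵥ* P = v := by
  have hdet : (P - 1).det = 0 := exists_mulVec_eq_zero_iff.mp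
    ⟨1, one_ne_zero, by simp [sub_mulVec, one_vecMul_of_mem_rowStochastic hP]⟩
  obtain ⟨w, hw0, hw⟩ := exists_vecMul_eq_zero_iff.mpr hdet
  have hfix : w ᵥ* P = w := by simpa [vecMul_sub, sub_eq_zero] using hw
  set u : n → ℝ := fun x => |w x| with hu
  have hle : ∀ y, u y ≤ (u ᵥ* P) y := fun y => by
    calc |w y| = |(w ᵥ* P) y| := by rw [hfix]
      _ ≤ ∑ x, |w x * P x y| := Finset.abs_sum_le_sum_abs _ _
      _ = (u ᵥ* P) y := by
        simp [vecMul, dotProduct, hu, abs_mul, abs_of_nonneg (nonneg_of_mem_rowStochastic hP)]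
  have huP : u ᵥ* P = u := by
    funext y
    exact ((Finset.sum_eq_sum_iff_of_le fun y _ => hle y).mp
      (sum_vecMul_of_mem_rowStochastic hP u).symm y (Finset.mem_univ y)).symm
  obtain ⟨x₀, hx₀⟩ := Function.ne_iff.mp hw0
  have hpos : 0 < ∑ x, u x :=
    Finset.sum_pos' (fun x _ => abs_nonneg _) ⟨x₀, Finset.mem_univ _, abs_pos.mpr hx₀⟩
  refine ⟨(∑ x, u x)⁻¹ • u, fun x => mul_nonneg (inv_nonneg.mpr hpos.le) (abs_nonneg _), ?_, ?_⟩
  · simp [← Finset.mul_sum, hpos.ne']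
  · rw [smul_vecMul, huP]

/-- Doeblin's contraction: if every row of `P` dominates `ν`, then `P` contracts the `ℓ¹` norm on
vectors of total mass zero by the factor `1 - ∑ ν`. -/
theorem sum_abs_vecMul_le_of_minorization (hP : P ∈ rowStochastic ℝ n) {ν : n → ℝ}
    (hν : ∀ x y, ν y ≤ P x y) {δ : n → ℝ} (hδ : ∑ x, δ x = 0) :
    ∑ y, |(δ ᵥ* P) y| ≤ (1 - ∑ y, ν y) * ∑ x, |δ x| := by
  calc ∑ y, |(δ ᵥ* P) y| = ∑ y, |∑ x, δ x * (P x y - ν y)| := by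
        simp [vecMul, dotProduct, mul_sub, ← Finset.sum_mul, hδ]
    _ ≤ ∑ y, ∑ x, |δ x| * (P x y - ν y) := by
        refine Finset.sum_le_sum fun y _ => (Finset.abs_sum_le_sum_abs _ _).trans_eq ?_
        simp [abs_mul, abs_of_nonneg (sub_nonneg.mpr (hν _ y))]
    _ = (1 - ∑ y, ν y) * ∑ x, |δ x| := by
        rw [Finset.sum_comm, Finset.mul_sum]
        simp [← Finset.mul_sum, sum_row_of_mem_rowStochastic hP, mul_comm]

theorem sum_abs_vecMul_pow_le_of_minorization (hP : P ∈ rowStochastic ℝ n) {ν : n → ℝ}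
    (hν : ∀ x y, ν y ≤ P x y) (hν1 : ∑ y, ν y ≤ 1) {δ : n → ℝ} (hδ : ∑ x, δ x = 0) (m : ℕ) :
    ∑ y, |(δ ᵥ* P ^ m) y| ≤ (1 - ∑ y, ν y) ^ m * ∑ x, |δ x| := by
  induction m with
  | zero => simp
  | succ m ih =>
    rw [pow_succ, ← vecMul_vecMul, pow_succ', mul_assoc]
    exact (sum_abs_vecMul_le_of_minorization hP hν
      ((sum_vecMul_of_mem_rowStochastic (pow_mem hP m) δ).trans hδ)).trans
      (mul_le_mul_of_nonneg_left ih (sub_nonneg.mpr hν1))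

theorem vecMul_pow_eq_self {v : n → ℝ} (hv : v ᵥ* P = v) (m : ℕ) : v ᵥ* P ^ m = v := by
  induction m with
  | zero => simp
  | succ m ih => rw [pow_succ, ← vecMul_vecMul, ih, hv]

/-- A minorized power forces the fixed row vectors of a given mass to be unique. -/
theorem eq_of_vecMul_eq_self_of_minorization (hP : P ∈ rowStochastic ℝ n) {ν : n → ℝ} {r : ℕ}
    (hν : ∀ x y, ν y ≤ (P ^ r) x y) (hν0 : 0 < ∑ y, ν y) {v w : n → ℝ}
    (hv : v ᵥ* P = v) (hw : w ᵥ* P = w) (hvw : ∑ x, v x = ∑ x, w x) : v = w := by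
  have h := sum_abs_vecMul_le_of_minorization (pow_mem hP r) hν (δ := v - w) (by simp [hvw])
  rw [sub_vecMul, vecMul_pow_eq_self hv, vecMul_pow_eq_self hw] at h
  have h0 : ∑ x, |(v - w) x| = 0 :=
    le_antisymm (by nlinarith) (Finset.sum_nonneg fun _ _ => abs_nonneg _)
  funext x
  have hx := (Finset.sum_eq_zero_iff_of_nonneg fun _ _ => abs_nonneg _).mp h0 x (Finset.mem_univ x)
  exact sub_eq_zero.mp (abs_eq_zero.mp hx)

/-- Mixing-time bound from a minorization of the `r`-th power by a measure of mass `α`. -/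
theorem exists_totalVariation_le_of_minorization (hP : P ∈ rowStochastic ℝ n) {ν : n → ℝ} {r : ℕ}
    (hν : ∀ x y, ν y ≤ (P ^ r) x y) (hν0 : 0 < ∑ y, ν y) (hν1 : ∑ y, ν y ≤ 1) {v : n → ℝ}
    (hv0 : ∀ x, 0 ≤ v x) (hv1 : ∑ x, v x = 1) (hv : v ᵥ* P = v) {ε : ℝ} (hε : 0 < ε)
    (hε1 : ε < 1) :
    ∃ t : ℕ, (t : ℝ) ≤ r / (∑ y, ν y) * (1 + Real.log (1 / ε)) ∧
      ∀ μ : n → ℝ, (∀ x, 0 ≤ μ x) → ∑ x, μ x = 1 →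
        (1 / 2) * ∑ y, |(μ ᵥ* P ^ t) y - v y| ≤ ε := by
  set α := ∑ y, ν y
  have hlog : 0 < Real.log (1 / ε) := Real.log_pos (one_lt_one_div hε hε1)
  refine ⟨r * ⌈Real.log (1 / ε) / α⌉₊, ?_, fun μ hμ0 hμ1 => ?_⟩
  · have hceil : (⌈Real.log (1 / ε) / α⌉₊ : ℝ) ≤ (1 + Real.log (1 / ε)) / α := by
      have h1 : 1 ≤ 1 / α := (one_le_div hν0).mpr hν1
      have h2 := Nat.ceil_lt_add_one (div_pos hlog hν0).le
      rw [add_div]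
      linarith
    push_cast
    calc (r : ℝ) * ⌈Real.log (1 / ε) / α⌉₊ ≤ r * ((1 + Real.log (1 / ε)) / α) :=
          mul_le_mul_of_nonneg_left hceil r.cast_nonneg
      _ = r / α * (1 + Real.log (1 / ε)) := by ring
  · set m := ⌈Real.log (1 / ε) / α⌉₊
    have h := sum_abs_vecMul_pow_le_of_minorization (pow_mem hP r) hν hν1 (δ := μ - v)
      (by simp [hμ1, hv1]) m
    rw [← pow_mul, sub_vecMul, vecMul_pow_eq_self hv] at h
    have hmass : ∑ x, |(μ - v) x| ≤ 2 := by
      calc ∑ x, |(μ - v) x| ≤ ∑ x, (μ x + v x) := Finset.sum_le_sum fun x _ =>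
            (abs_sub _ _).trans_eq (by rw [abs_of_nonneg (hμ0 x), abs_of_nonneg (hv0 x)])
        _ = 2 := by rw [Finset.sum_add_distrib, hμ1, hv1]; norm_num
    have hpow : (1 - α) ^ m ≤ ε := by
      have hm : Real.log (1 / ε) ≤ m * α := (div_le_iff₀ hν0).mp (Nat.le_ceil _)
      calc (1 - α) ^ m ≤ Real.exp (-α) ^ m :=
            pow_le_pow_left₀ (sub_nonneg.mpr hν1) (Real.one_sub_le_exp_neg α) m
        _ = Real.exp (-(m * α)) := by rw [← Real.exp_nat_mul]; ring_nf
        _ ≤ Real.exp (Real.log ε) := Real.exp_le_exp.mpr (by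
            rw [one_div, Real.log_inv] at hm; linarith)
        _ = ε := Real.exp_log hε
    have := mul_le_mul hpow hmass (Finset.sum_nonneg fun _ _ => abs_nonneg _) hε.le
    simp only [Pi.sub_apply] at h this
    linarith

end Stochastic

section Chain

open Matrix

theorem sum_offDiag_fin_three (g : {kl : Fin 3 × Fin 3 // kl.1 ≠ kl.2} → ℝ) :
    ∑ kl, g kl = g ⟨(0, 1), by decide⟩ + g ⟨(0, 2), by decide⟩ + g ⟨(1, 0), by decide⟩ +
      g ⟨(1, 2), by decide⟩ + g ⟨(2, 0), by decide⟩ + g ⟨(2, 1), by decide⟩ := by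
  have h : (Finset.univ : Finset {kl : Fin 3 × Fin 3 // kl.1 ≠ kl.2}) =
      {⟨(0, 1), by decide⟩, ⟨(0, 2), by decide⟩, ⟨(1, 0), by decide⟩,
        ⟨(1, 2), by decide⟩, ⟨(2, 0), by decide⟩, ⟨(2, 1), by decide⟩} := by decide
  rw [h]
  simp [add_assoc]

theorem sum_edge (g : Edge → ℝ) : ∑ e, g e = g Edge.b + g Edge.f := by
  have h : (Finset.univ : Finset Edge) = {Edge.b, Edge.f} := rfl
  simp [h]

theorem Qmat_mulVec_inl (qv : Fin 3 → ℝ) (f : St → ℝ) (e : Edge) {k l m : Fin 3}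
    (hkl : k ≠ l) (hkm : k ≠ m) (hlm : l ≠ m) :
    (Qmat qv *ᵥ f) (Sum.inl (e, k)) =
      qv m * f (Sum.inl (Edge.b, l)) + qv l * f (Sum.inl (Edge.b, m)) +
      (1 - (qv 0 + qv 1 + qv 2)) / 2 *
        (f (Sum.inr (Edge.f, ⟨(k, l), hkl⟩)) + f (Sum.inr (Edge.f, ⟨(k, m), hkm⟩))) +
      qv k / 2 *
        (f (Sum.inr (Edge.b, ⟨(k, l), hkl⟩)) + f (Sum.inr (Edge.b, ⟨(k, m), hkm⟩))) := by
  simp only [mulVec, dotProduct, Fintype.sum_sum_type, Fintype.sum_prod_type, sum_edge,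
    sum_offDiag_fin_three, Fin.sum_univ_three, Qmat, of_apply]
  fin_cases k <;> fin_cases l <;> fin_cases m <;> first | contradiction | (simp [third]; ring)

theorem Qmat_mulVec_inr (qv : Fin 3 → ℝ) (f : St → ℝ) (e : Edge) {k l m : Fin 3}
    (hkl : k ≠ l) (hkm : k ≠ m) (hlm : l ≠ m) :
    (Qmat qv *ᵥ f) (Sum.inr (e, ⟨(k, l), hkl⟩)) =
      qv m * f (Sum.inl (Edge.b, k)) +
      (1 - (qv 0 + qv 1 + qv 2)) * f (Sum.inl (Edge.f, m)) +
      qv k * f (Sum.inr (Edge.b, ⟨(k, m), hkm⟩)) +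
      qv l * f (Sum.inr (Edge.b, ⟨(l, m), hlm⟩)) := by
  simp only [mulVec, dotProduct, Fintype.sum_sum_type, Fintype.sum_prod_type, sum_edge,
    sum_offDiag_fin_three, Fin.sum_univ_three, Qmat, of_apply]
  fin_cases k <;> fin_cases l <;> fin_cases m <;> first | contradiction | (simp [third]; ring)


theorem Qmat_mem_rowStochastic {qv : Fin 3 → ℝ} (h0 : ∀ k, 0 ≤ qv k)
    (h1 : qv 0 + qv 1 + qv 2 ≤ 1) : Qmat qv ∈ rowStochastic ℝ St := by
  have hp : 0 ≤ 1 - (qv 0 + qv 1 + qv 2) := sub_nonneg.mpr h1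
  refine mem_rowStochastic.mpr ⟨?_, ?_⟩
  · rintro (⟨e, k⟩ | ⟨e, kl⟩) (⟨_ | _, j⟩ | ⟨_ | _, kl'⟩) <;>
      simp only [Qmat, of_apply] <;> (try split_ifs) <;> (try exact h0 _) <;>
      first | positivity | exact div_nonneg (h0 _) zero_le_two
  · funext x
    rcases x with ⟨e, k⟩ | ⟨e, ⟨⟨k, l⟩, hkl⟩⟩
    · obtain ⟨l, m, hkl, hkm, hlm⟩ : ∃ l m : Fin 3, k ≠ l ∧ k ≠ m ∧ l ≠ m := by
        decide +revert
      rw [Qmat_mulVec_inl qv 1 e hkl hkm hlm]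
      fin_cases k <;> fin_cases l <;> fin_cases m <;> first | contradiction | (simp; ring)
    · obtain ⟨m, hkm, hlm⟩ : ∃ m : Fin 3, k ≠ m ∧ l ≠ m := by
        clear hkl
        decide +revert
      rw [Qmat_mulVec_inr qv 1 e hkl hkm hlm]
      fin_cases k <;> fin_cases l <;> fin_cases m <;> first | contradiction | (simp; ring)

theorem exists_pow_pos_of_transGen {n : Type*} [Fintype n] [DecidableEq n] {M : Matrix n n ℝ}
    (hM : ∀ x y, 0 ≤ M x y) {x y : n} (h : Relation.TransGen (fun x y => 0 < M x y) x y) :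
    ∃ t : ℕ, 1 ≤ t ∧ 0 < (M ^ t) x y := by
  induction h with
  | single h => exact ⟨1, le_rfl, by simpa using h⟩
  | @tail y z _ hyz ih =>
    obtain ⟨t, _, hpos⟩ := ih
    refine ⟨t + 1, by omega, ?_⟩
    rw [pow_succ, mul_apply]
    exact Finset.sum_pos' (fun w _ => mul_nonneg (pow_apply_nonneg hM t x w) (hM w z))
      ⟨y, Finset.mem_univ y, mul_pos hpos hyz⟩

theorem Qmat_irreducible {qv : Fin 3 → ℝ} (h0 : ∀ k, 0 < qv k)
    (h1 : qv 0 + qv 1 + qv 2 < 1) (V V' : St) : ∃ t : ℕ, 1 ≤ t ∧ 0 < (Qmat qv ^ t) V V' := by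
  have hp : 0 < 1 - (qv 0 + qv 1 + qv 2) := sub_pos.mpr h1
  refine exists_pow_pos_of_transGen
    (fun x y => nonneg_of_mem_rowStochastic (Qmat_mem_rowStochastic (fun k => (h0 k).le) h1.le)) ?_
  set R := Relation.TransGen fun x y => 0 < Qmat qv x y
  have hAA : ∀ e k j, j ≠ k → R (Sum.inl (e, k)) (Sum.inl (Edge.b, j)) := fun e k j hj =>
    .single (by simp [Qmat, hj, h0])
  have hAB : ∀ e e' k l (hkl : k ≠ l), R (Sum.inl (e, k)) (Sum.inr (e', ⟨(k, l), hkl⟩)) :=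
    fun e e' k l hkl => .single (by cases e' <;> simp [Qmat, h0, hp])
  have hBA : ∀ e k l (hkl : k ≠ l), R (Sum.inr (e, ⟨(k, l), hkl⟩)) (Sum.inl (Edge.b, k)) :=
    fun e k l hkl => .single (by simp [Qmat, h0])
  have hBAf : ∀ e k l (hkl : k ≠ l),
      R (Sum.inr (e, ⟨(k, l), hkl⟩)) (Sum.inl (Edge.f, third k l)) :=
    fun e k l hkl => .single (by simp [Qmat, hp])
  have hAb : ∀ e k j, R (Sum.inl (e, k)) (Sum.inl (Edge.b, j)) := by
    intro e k j
    by_cases hj : j = k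
    · subst hj
      obtain ⟨l, hl⟩ : ∃ l, l ≠ j := exists_ne j
      exact (hAA e j l hl).trans (hAA _ l j hl.symm)
    · exact hAA e k j hj
  have hA : ∀ e k W, R (Sum.inl (e, k)) W := by
    rintro e k (⟨_ | _, j⟩ | ⟨e', ⟨⟨j, l⟩, hjl⟩⟩)
    · exact hAb e k j
    · obtain ⟨i, l, hil, rfl⟩ : ∃ i l, i ≠ l ∧ third i l = j := by decide +revert
      exact ((hAb e k i).trans (hAB _ Edge.b i l hil)).trans (hBAf _ i l hil)
    · exact (hAb e k j).trans (hAB _ e' j l hjl)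
  rcases V with ⟨e, k⟩ | ⟨e, ⟨⟨k, l⟩, hkl⟩⟩
  · exact hA e k V'
  · exact (hBA e k l hkl).trans (hA _ k V')

/-- Two steps of the chain lead from `A^(k)` to `A^(m)`, `m ≠ k`, with probability bounded below
uniformly in `q`. -/
theorem le_Qmat_sq_mulVec_inl {q : ℝ} {qv : Fin 3 → ℝ} (hq0 : 0 ≤ q) (hq1 : q ≤ 1)
    (hsum : qv 0 + qv 1 + qv 2 = q) (hqv : ∀ k, q / 6 ≤ qv k) {f : St → ℝ} (hf : ∀ x, 0 ≤ f x)
    {c : ℝ} (hc : 0 ≤ c) {m : Fin 3} (hfm : ∀ e, c ≤ f (Sum.inl (e, m))) (e : Edge) {k : Fin 3}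
    (hkm : k ≠ m) : c / 36 ≤ (Qmat qv *ᵥ (Qmat qv *ᵥ f)) (Sum.inl (e, k)) := by
  have hqv0 : ∀ k, 0 ≤ qv k := fun k => le_trans (by positivity) (hqv k)
  have hP := Qmat_mem_rowStochastic hqv0 (hsum.trans_le hq1)
  set g := Qmat qv *ᵥ f with hg_def
  have hg : ∀ x, 0 ≤ g x := nonneg_mulVec_of_mem_rowStochastic hP hf
  obtain ⟨l, hkl, hlm⟩ : ∃ l : Fin 3, k ≠ l ∧ l ≠ m := by
    clear hfm
    decide +revert
  have hp : 0 ≤ 1 - q := sub_nonneg.mpr hq1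
  have hgA : qv k * c ≤ g (Sum.inl (Edge.b, l)) := by
    rw [hg_def, Qmat_mulVec_inl qv f Edge.b hkl.symm hlm hkm, hsum]
    have := mul_le_mul_of_nonneg_left (hfm Edge.b) (hqv0 k)
    have := mul_nonneg (hqv0 m) (hf (Sum.inl (Edge.b, k)))
    have := mul_nonneg (div_nonneg hp zero_le_two)
      (add_nonneg (hf (Sum.inr (Edge.f, ⟨(l, k), hkl.symm⟩)))
        (hf (Sum.inr (Edge.f, ⟨(l, m), hlm⟩))))
    have := mul_nonneg (div_nonneg (hqv0 l) zero_le_two)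
      (add_nonneg (hf (Sum.inr (Edge.b, ⟨(l, k), hkl.symm⟩)))
        (hf (Sum.inr (Edge.b, ⟨(l, m), hlm⟩))))
    linarith
  have hgB : ∀ e, (1 - q) * c ≤ g (Sum.inr (e, ⟨(k, l), hkl⟩)) := fun e => by
    rw [hg_def, Qmat_mulVec_inr qv f e hkl hkm hlm, hsum]
    have := mul_le_mul_of_nonneg_left (hfm Edge.f) hp
    have := mul_nonneg (hqv0 m) (hf (Sum.inl (Edge.b, k)))
    have := mul_nonneg (hqv0 k) (hf (Sum.inr (Edge.b, ⟨(k, m), hkm⟩)))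
    have := mul_nonneg (hqv0 l) (hf (Sum.inr (Edge.b, ⟨(l, m), hlm⟩)))
    linarith
  have hconst : 1 / 36 ≤ qv m * qv k + (1 - q + qv k) / 2 * (1 - q) := by
    have h1 := mul_le_mul (hqv m) (hqv k) (by positivity) (hqv0 m)
    have h2 : (1 - q + q / 6) / 2 * (1 - q) ≤ (1 - q + qv k) / 2 * (1 - q) :=
      mul_le_mul_of_nonneg_right (by linarith [hqv k]) hp
    nlinarith
  calc c / 36 = 1 / 36 * c := by ring
    _ ≤ (qv m * qv k + (1 - q + qv k) / 2 * (1 - q)) * c := mul_le_mul_of_nonneg_right hconst hc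
    _ = qv m * (qv k * c) + (1 - q) / 2 * ((1 - q) * c) + qv k / 2 * ((1 - q) * c) := by ring
    _ ≤ qv m * g (Sum.inl (Edge.b, l)) + qv l * g (Sum.inl (Edge.b, m)) +
      (1 - q) / 2 * (g (Sum.inr (Edge.f, ⟨(k, l), hkl⟩)) + g (Sum.inr (Edge.f, ⟨(k, m), hkm⟩))) +
      qv k / 2 * (g (Sum.inr (Edge.b, ⟨(k, l), hkl⟩)) + g (Sum.inr (Edge.b, ⟨(k, m), hkm⟩))) := by
        have h1 := mul_le_mul_of_nonneg_left hgA (hqv0 m)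
        have h2 := mul_nonneg (hqv0 l) (hg (Sum.inl (Edge.b, m)))
        have h3 := mul_le_mul_of_nonneg_left
          (le_add_of_le_of_nonneg (hgB Edge.f) (hg (Sum.inr (Edge.f, ⟨(k, m), hkm⟩))))
          (div_nonneg hp zero_le_two)
        have h4 := mul_le_mul_of_nonneg_left
          (le_add_of_le_of_nonneg (hgB Edge.b) (hg (Sum.inr (Edge.b, ⟨(k, m), hkm⟩))))
          (div_nonneg (hqv0 k) zero_le_two)
        linarith
    _ = (Qmat qv *ᵥ g) (Sum.inl (e, k)) := by rw [Qmat_mulVec_inl qv g e hkl hkm hlm, hsum]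

/-- Two steps of the chain lead from `B^(kl)` to `A^(k)`, and to `A^(l)`, with probability at least
of order `q`. -/
theorem le_Qmat_sq_mulVec_inr {q : ℝ} {qv : Fin 3 → ℝ} (hq0 : 0 ≤ q) (hq1 : q ≤ 1)
    (hsum : qv 0 + qv 1 + qv 2 = q) (hqv : ∀ k, q / 6 ≤ qv k) {f : St → ℝ} (hf : ∀ x, 0 ≤ f x)
    {c : ℝ} (hc : 0 ≤ c) {k l : Fin 3} (hkl : k ≠ l)
    (hfkl : (∀ e, c ≤ f (Sum.inl (e, k))) ∨ ∀ e, c ≤ f (Sum.inl (e, l))) (e : Edge) :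
    q / 36 * c ≤ (Qmat qv *ᵥ (Qmat qv *ᵥ f)) (Sum.inr (e, ⟨(k, l), hkl⟩)) := by
  have hqv0 : ∀ k, 0 ≤ qv k := fun k => le_trans (by positivity) (hqv k)
  have hP := Qmat_mem_rowStochastic hqv0 (hsum.trans_le hq1)
  set g := Qmat qv *ᵥ f with hg_def
  have hg : ∀ x, 0 ≤ g x := nonneg_mulVec_of_mem_rowStochastic hP hf
  obtain ⟨m, hkm, hlm⟩ : ∃ m : Fin 3, k ≠ m ∧ l ≠ m := by
    clear hfkl hkl
    decide +revert
  have hp : 0 ≤ 1 - q := sub_nonneg.mpr hq1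
  have hgB : ∀ {i j r : Fin 3} (hij : i ≠ j) (_ : i ≠ r) (_ : j ≠ r),
      qv r * f (Sum.inl (Edge.b, i)) + (1 - q) * f (Sum.inl (Edge.f, r)) ≤
        g (Sum.inr (Edge.b, ⟨(i, j), hij⟩)) := fun {i j r} hij hir hjr => by
    rw [hg_def, Qmat_mulVec_inr qv f Edge.b hij hir hjr, hsum]
    have := mul_nonneg (hqv0 i) (hf (Sum.inr (Edge.b, ⟨(i, r), hir⟩)))
    have := mul_nonneg (hqv0 j) (hf (Sum.inr (Edge.b, ⟨(j, r), hjr⟩)))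
    linarith
  have hgk := mul_le_mul_of_nonneg_left (hgB hkm hkl hlm.symm) (hqv0 k)
  have hgl := mul_le_mul_of_nonneg_left (hgB hlm hkl.symm hkm.symm) (hqv0 l)
  have hconst : ∀ i j, q / 36 * c ≤ qv i * ((qv j + (1 - q)) * c) := fun i j => by
    have h1 : q / 6 * (1 / 6) ≤ qv i * (qv j + (1 - q)) :=
      mul_le_mul (hqv i) (by linarith [hqv j]) (by norm_num) (hqv0 i)
    have h2 := mul_le_mul_of_nonneg_right h1 hc
    linarith
  rw [Qmat_mulVec_inr qv g e hkl hkm hlm, hsum]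
  have hA := mul_nonneg (hqv0 m) (hg (Sum.inl (Edge.b, k)))
  have hAf := mul_nonneg hp (hg (Sum.inl (Edge.f, m)))
  rcases hfkl with hfk | hfl
  · have h1 := mul_le_mul_of_nonneg_left (hfk Edge.b) (mul_nonneg (hqv0 k) (hqv0 l))
    have h2 := mul_le_mul_of_nonneg_left (hfk Edge.f) (mul_nonneg (hqv0 l) hp)
    have h3 := mul_nonneg (mul_nonneg (hqv0 k) hp) (hf (Sum.inl (Edge.f, l)))
    have h4 := mul_nonneg (mul_nonneg (hqv0 l) (hqv0 k)) (hf (Sum.inl (Edge.b, l)))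
    linarith [hconst l k]
  · have h1 := mul_le_mul_of_nonneg_left (hfl Edge.b) (mul_nonneg (hqv0 l) (hqv0 k))
    have h2 := mul_le_mul_of_nonneg_left (hfl Edge.f) (mul_nonneg (hqv0 k) hp)
    have h3 := mul_nonneg (mul_nonneg (hqv0 l) hp) (hf (Sum.inl (Edge.f, k)))
    have h4 := mul_nonneg (mul_nonneg (hqv0 k) (hqv0 l)) (hf (Sum.inl (Edge.b, k)))
    linarith [hconst k l]

/-- Every state reaches `A^(0)` in four steps with probability at least of order `q`; the row of
`A_b^(0)` therefore minorizes all rows of the fifth power. -/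
theorem Qmat_pow_five_minorization {q : ℝ} {qv : Fin 3 → ℝ} (hq0 : 0 ≤ q) (hq1 : q ≤ 1)
    (hsum : qv 0 + qv 1 + qv 2 = q) (hqv : ∀ k, q / 6 ≤ qv k) (x y : St) :
    q / 1296 * Qmat qv (Sum.inl (Edge.b, 0)) y ≤ (Qmat qv ^ 5) x y := by
  have hqv0 : ∀ k, 0 ≤ qv k := fun k => le_trans (by positivity) (hqv k)
  have hP := Qmat_mem_rowStochastic hqv0 (hsum.trans_le hq1)
  set f : St → ℝ := Sum.elim (fun a => if a.2 = 0 then 1 else 0) (fun _ => 0) with hf_def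
  have hf : ∀ x, 0 ≤ f x := by
    rintro (a | a) <;> simp only [hf_def, Sum.elim_inl, Sum.elim_inr] <;> (try split_ifs) <;>
      norm_num
  set g := Qmat qv *ᵥ (Qmat qv *ᵥ f)
  have hg : ∀ x, 0 ≤ g x := nonneg_mulVec_of_mem_rowStochastic hP
    (nonneg_mulVec_of_mem_rowStochastic hP hf)
  have hgA : ∀ e k, k ≠ 0 → 1 / 36 ≤ g (Sum.inl (e, k)) := fun e k hk =>
    le_Qmat_sq_mulVec_inl hq0 hq1 hsum hqv hf zero_le_one (fun e => by simp [hf_def]) e hk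
  have hreach : q / 1296 ≤ (Qmat qv *ᵥ (Qmat qv *ᵥ g)) x := by
    rcases x with ⟨e, k⟩ | ⟨e, ⟨⟨k, l⟩, hkl⟩⟩
    · obtain ⟨m, hkm, hm⟩ : ∃ m : Fin 3, k ≠ m ∧ m ≠ 0 := by decide +revert
      have := le_Qmat_sq_mulVec_inl hq0 hq1 hsum hqv hg (by norm_num) (fun e => hgA e m hm) e hkm
      linarith
    · have hkl0 : k ≠ 0 ∨ l ≠ 0 := by
        by_contra! h
        exact hkl (h.1.trans h.2.symm)
      have := le_Qmat_sq_mulVec_inr hq0 hq1 hsum hqv hg (by norm_num : (0 : ℝ) ≤ 1 / 36) hkl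
        (hkl0.imp (fun h e => hgA e k h) fun h e => hgA e l h) e
      linarith
  have hrow : ∀ z, f z * Qmat qv (Sum.inl (Edge.b, 0)) y ≤ f z * Qmat qv z y := by
    rintro (⟨e, k⟩ | a)
    · by_cases hk : k = 0
      · subst hk
        exact (congrArg (f (Sum.inl (e, 0)) * ·)
          (by rcases y with ⟨_ | _, j⟩ | ⟨_ | _, j⟩ <;> rfl)).le
      · simp [hf_def, hk]
    · simp [hf_def]
  have hf1 : ∀ z, f z ≤ 1 := by
    rintro (a | a) <;> simp only [hf_def, Sum.elim_inl, Sum.elim_inr] <;> (try split_ifs) <;>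
      norm_num
  have hpow : Qmat qv *ᵥ (Qmat qv *ᵥ g) = Qmat qv ^ 4 *ᵥ f := by
    simp only [g, mulVec_mulVec, pow_succ, pow_zero, one_mul, mul_assoc]
  calc q / 1296 * Qmat qv (Sum.inl (Edge.b, 0)) y
      ≤ (Qmat qv ^ 4 *ᵥ f) x * Qmat qv (Sum.inl (Edge.b, 0)) y :=
        mul_le_mul_of_nonneg_right (hpow ▸ hreach) (nonneg_of_mem_rowStochastic hP)
    _ = ∑ z, (Qmat qv ^ 4) x z * (f z * Qmat qv (Sum.inl (Edge.b, 0)) y) := by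
        simp only [mulVec, dotProduct, Finset.sum_mul, mul_assoc]
    _ ≤ ∑ z, (Qmat qv ^ 4) x z * Qmat qv z y := Finset.sum_le_sum fun z _ =>
        mul_le_mul_of_nonneg_left ((hrow z).trans
          (mul_le_of_le_one_left (nonneg_of_mem_rowStochastic hP) (hf1 z)))
          (nonneg_of_mem_rowStochastic (pow_mem hP 4))
    _ = (Qmat qv ^ 5) x y := by rw [pow_succ _ 4, mul_apply]

end Chain

/-- There are constants `γ₀ ∈ (0,1)` and `K > 0` such that whenever `q ∈ (0,1)`,
`γ ∈ (0,γ₀)`, and `q₁+q₂+q₃ = q` with `(1−γ)q/3 < q_k < (1+γ)q/3` for each `k`, the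
matrix `Q` is irreducible with unique stationary distribution `π`, and for every
`ε ∈ (0,1)` the mixing time satisfies `t_mix(ε) ≤ (K/q)(1 + log(1/ε))`: there is a
time `t` below that bound at which every initial distribution `μ` satisfies
`‖μQ^t − π‖_TV ≤ ε` (total variation being half the `ℓ¹` distance). -/
theorem stmt13 :
    ∃ γ₀ K : ℝ, 0 < γ₀ ∧ γ₀ < 1 ∧ 0 < K ∧
      ∀ (q γ : ℝ) (qv : Fin 3 → ℝ), 0 < q → q < 1 → 0 < γ → γ < γ₀ →
        (∀ k, 0 < qv k) → qv 0 + qv 1 + qv 2 = q →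
        (∀ k, (1 - γ) * (q / 3) < qv k ∧ qv k < (1 + γ) * (q / 3)) →
        (∀ V V' : St, ∃ t : ℕ, 1 ≤ t ∧ 0 < (Qmat qv ^ t) V V') ∧
        (∃! π : St → ℝ, (∀ V, 0 ≤ π V) ∧ (∑ V : St, π V) = 1 ∧
            ∀ V' : St, (∑ V : St, π V * Qmat qv V V') = π V') ∧
        ∀ π : St → ℝ,
          ((∀ V, 0 ≤ π V) ∧ (∑ V : St, π V) = 1 ∧
            ∀ V' : St, (∑ V : St, π V * Qmat qv V V') = π V') →
          ∀ ε : ℝ, 0 < ε → ε < 1 →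
            ∃ t : ℕ, (t : ℝ) ≤ K / q * (1 + Real.log (1 / ε)) ∧
              ∀ μ : St → ℝ, (∀ V, 0 ≤ μ V) → (∑ V : St, μ V) = 1 →
                (1 / 2) * (∑ V' : St, |(∑ V : St, μ V * (Qmat qv ^ t) V V') - π V'|)
                  ≤ ε := by
  refine ⟨1 / 2, 6480, by norm_num, by norm_num, by norm_num, ?_⟩
  intro q γ qv hq0 hq1 _ hγ hqv0 hsum hbal
  have hqv : ∀ k, q / 6 ≤ qv k := fun k => by nlinarith [(hbal k).1]
  have hP := Qmat_mem_rowStochastic (fun k => (hqv0 k).le) (hsum.trans_le hq1.le)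
  have hmin := Qmat_pow_five_minorization hq0.le hq1.le hsum hqv
  have hmass : ∑ y, q / 1296 * Qmat qv (Sum.inl (Edge.b, 0)) y = q / 1296 := by
    rw [← Finset.mul_sum, Matrix.sum_row_of_mem_rowStochastic hP, mul_one]
  have hmass0 : 0 < ∑ y, q / 1296 * Qmat qv (Sum.inl (Edge.b, 0)) y := by
    rw [hmass]
    positivity
  refine ⟨Qmat_irreducible hqv0 (hsum.trans_lt hq1), ?_, ?_⟩
  · have : Nonempty St := ⟨Sum.inl (Edge.b, 0)⟩
    obtain ⟨v, hv0, hv1, hv⟩ := exists_stationary_of_mem_rowStochastic hP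
    refine ⟨v, ⟨hv0, hv1, congrFun hv⟩, fun w ⟨_, hw1, hw⟩ => ?_⟩
    exact eq_of_vecMul_eq_self_of_minorization hP hmin hmass0 (funext hw) hv (hw1.trans hv1.symm)
  · rintro π ⟨hπ0, hπ1, hπ⟩ ε hε hε1
    obtain ⟨t, ht, htv⟩ := exists_totalVariation_le_of_minorization hP hmin hmass0
      (by rw [hmass]; linarith) hπ0 hπ1 (funext hπ) hε hε1
    refine ⟨t, ht.trans_eq ?_, htv⟩
    rw [hmass]
    field_simp
    ring
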